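/- Let j ≥ 1 and let m ≥ 0 be the unique integer with q^m ≤ j + 1 < q^{m+1} (i.e. m = ⌊log_q(j+1)⌋). Then the Bernoulli–Goss number β(j) has degree at most j·m in θ; consequently, for every monic irreducible π ∈ A of degree d, the π-adic valuation v_π(β(j)) (which is finite since β(j) ≠ 0) satisfies d·v_π(β(j)) ≤ j·m. (This is the content of the paper's bound m_𝔭(i) ≤ (i/d)·log_q(i+1).) -/

import Mathlib

open Polynomial

/-- `S n j = Σ_{a monic, deg a = n} a^j`, where monic polynomials of degree `n`
over `F` are parametrized bijectively by their lower-order coefficients `c : Fin n → F`. -/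
noncomputable def Smon (F : Type) [Field F] [Fintype F] (n j : ℕ) : Polynomial F :=
  ∑ c : Fin n → F, (X ^ n + ∑ i : Fin n, C (c i) * X ^ (i : ℕ)) ^ j

/-- `Z(X,j) = Σ_{n=0}^{j+1} S_n(j) X^n ∈ A[X]` (which equals the full sum `Σ_{n≥0}`
since `S_n(j) = 0` for `q^n - 1 > j`). -/
noncomputable def Zpoly (F : Type) [Field F] [Fintype F] (j : ℕ) :
    Polynomial (Polynomial F) :=
  ∑ n ∈ Finset.range (j + 2), C (Smon F n j) * X ^ n

/-- The Bernoulli–Goss number `β(j) ∈ A`:  `β(j) = Z(1,j)` if `j = 0` or `(q-1) ∤ j`,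
and `β(j) = -(d/dX)Z(X,j)|_{X=1}` if `j ≥ 1` and `(q-1) ∣ j`. -/
noncomputable def bg (F : Type) [Field F] [Fintype F] (j : ℕ) : Polynomial F :=
  if j = 0 ∨ ¬ ((Fintype.card F - 1) ∣ j) then (Zpoly F j).eval 1
  else -((Polynomial.derivative (Zpoly F j)).eval 1)

/-- Power sums over a translate of a finite additive subgroup `V` of a domain vanish for
exponents below `#V - 1`, by Lagrange interpolation of `X ^ j` at the points of the translate. -/
theorem sum_add_pow_eq_zero_of_lt_card {V R : Type*} [AddCommGroup V] [Fintype V]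
    [CommRing R] [IsDomain R] (g : V →+ R) (hg : Function.Injective g) (t : R) (j : ℕ)
    (hj : j + 1 < Fintype.card V) : ∑ v, (t + g v) ^ j = 0 := by
  classical
  let K := FractionRing R
  let ι : R →+* K := algebraMap R K
  have hι : Function.Injective ι := IsFractionRing.injective R K
  let w : V → K := fun v => ι (t + g v)
  have hw : Function.Injective w := fun a b h => hg (add_left_cancel (hι h))
  have hdeg : (X ^ j : K[X]).degree < (Finset.univ : Finset V).card := by
    rw [degree_X_pow, Finset.card_univ]
    exact_mod_cast (by omega : j < Fintype.card V)
  have key := Lagrange.coeff_eq_sum (hw.injOn (s := ↑(Finset.univ : Finset V))) hdeg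
  have hprod : ∀ v : V, ∏ u ∈ Finset.univ.erase v, (w v - w u)
      = ∏ u ∈ Finset.univ.erase (0 : V), ι (g u) := by
    intro v
    refine Finset.prod_nbij' (fun u => v - u) (fun u => v - u) ?_ ?_ ?_ ?_ ?_
    · simp [sub_eq_zero, eq_comm]
    · simp
    · simp
    · simp
    · intro u _
      simp only [w, ← map_sub]
      congr 1
      rw [map_sub]
      ring
  simp only [hprod, eval_pow, eval_X, ← Finset.sum_div] at key
  rw [coeff_X_pow, if_neg (by rw [Finset.card_univ]; omega), eq_comm, div_eq_zero_iff] at key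
  have hne : ∏ u ∈ Finset.univ.erase (0 : V), ι (g u) ≠ 0 := by
    refine Finset.prod_ne_zero_iff.2 fun u hu h => Finset.ne_of_mem_erase hu ?_
    exact (map_eq_zero_iff g hg).1 ((map_eq_zero_iff ι hι).1 h)
  apply hι
  simpa [w] using key.resolve_right hne

/-- The polynomial with coefficients `c i` in degrees `i < n`, as an additive map. -/
noncomputable def lowerTerms (F : Type) [Field F] (n : ℕ) : (Fin n → F) →+ F[X] where
  toFun c := ∑ i : Fin n, C (c i) * X ^ (i : ℕ)
  map_zero' := by simp
  map_add' c d := by simp [add_mul, Finset.sum_add_distrib]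

theorem lowerTerms_injective (F : Type) [Field F] (n : ℕ) :
    Function.Injective (lowerTerms F n) := by
  intro c d h
  funext i
  have := congrArg (fun p => p.coeff (i : ℕ)) h
  simpa [lowerTerms, finsetSum_coeff, coeff_X_pow, Fin.val_inj] using this

theorem Smon_eq_zero (F : Type) [Field F] [Fintype F] (n j : ℕ)
    (h : j + 1 < Fintype.card F ^ n) : Smon F n j = 0 :=
  sum_add_pow_eq_zero_of_lt_card (lowerTerms F n) (lowerTerms_injective F n) (X ^ n) j
    (by simpa using h)

theorem natDegree_Smon_le (F : Type) [Field F] [Fintype F] (n j : ℕ) :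
    (Smon F n j).natDegree ≤ j * n := by
  refine natDegree_sum_le_of_forall_le _ _ fun c _ => natDegree_pow_le_of_le j ?_
  refine natDegree_add_le_of_degree_le (natDegree_X_pow_le n) ?_
  exact natDegree_sum_le_of_forall_le _ _ fun i _ =>
    (natDegree_C_mul_X_pow_le _ _).trans i.2.le

theorem natDegree_Smon_le_of_lt (F : Type) [Field F] [Fintype F] (n j m : ℕ)
    (h : j + 1 < Fintype.card F ^ (m + 1)) : (Smon F n j).natDegree ≤ j * m := by
  rcases le_or_gt n m with hnm | hnm
  · exact (natDegree_Smon_le F n j).trans (Nat.mul_le_mul_left j hnm)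
  · rw [Smon_eq_zero F n j (h.trans_le (Nat.pow_le_pow_right Fintype.card_pos hnm))]
    simp

theorem eval_Zpoly_one (F : Type) [Field F] [Fintype F] (j : ℕ) :
    (Zpoly F j).eval 1 = ∑ n ∈ Finset.range (j + 2), Smon F n j := by
  simp [Zpoly, eval_finsetSum]

theorem eval_derivative_Zpoly_one (F : Type) [Field F] [Fintype F] (j : ℕ) :
    (derivative (Zpoly F j)).eval 1 = ∑ n ∈ Finset.range (j + 2), Smon F n j * (n : F[X]) := by
  simp [Zpoly, eval_finsetSum, derivative_X_pow]

theorem natDegree_bg_le (F : Type) [Field F] [Fintype F] (j m : ℕ)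
    (h : j + 1 < Fintype.card F ^ (m + 1)) : (bg F j).natDegree ≤ j * m := by
  unfold bg
  split_ifs
  · rw [eval_Zpoly_one]
    exact natDegree_sum_le_of_forall_le _ _ fun n _ => natDegree_Smon_le_of_lt F n j m h
  · rw [natDegree_neg, eval_derivative_Zpoly_one]
    refine natDegree_sum_le_of_forall_le _ _ fun n _ => ?_
    refine natDegree_mul_le.trans ?_
    simpa using natDegree_Smon_le_of_lt F n j m h

theorem eval_zero_Smon_zero (F : Type) [Field F] [Fintype F] (j : ℕ) :
    (Smon F 0 j).eval 0 = 1 := by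
  simp [Smon]

theorem eval_zero_Smon_succ (F : Type) [Field F] [Fintype F] (n j : ℕ) :
    (Smon F (n + 1) j).eval 0 = (Fintype.card F : F) ^ n * ∑ x : F, x ^ j := by
  rw [Smon, eval_finsetSum, ← (Fin.consEquiv fun _ : Fin (n + 1) => F).sum_comp,
    Fintype.sum_prod_type]
  simp [eval_finsetSum, Fin.sum_univ_succ, Fin.consEquiv, Finset.mul_sum]

theorem sum_pow_eq_ite (F : Type) [Field F] [Fintype F] (j : ℕ) (hj : j ≠ 0) :
    ∑ x : F, x ^ j = if Fintype.card F - 1 ∣ j then -1 else 0 := by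
  classical
  rw [← FiniteField.sum_pow_units F j]
  refine (Finset.sum_of_injOn (fun u : Fˣ => (u : F)) Units.val_injective.injOn (by simp)
    (fun x _ hx => ?_) fun u _ => rfl).symm
  have hx0 : x = 0 := by
    by_contra h
    exact hx ⟨Units.mk0 x h, by simp, rfl⟩
  rw [hx0, zero_pow hj]

theorem eval_zero_bg (F : Type) [Field F] [Fintype F] (j : ℕ) (hj : j ≠ 0) :
    (bg F j).eval 0 = 1 := by
  have hS : ∀ n, (Smon F (n + 2) j).eval 0 = 0 := fun n => by
    simp [eval_zero_Smon_succ]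
  unfold bg
  split_ifs with h
  · have hnd := h.resolve_left hj
    rw [eval_Zpoly_one, eval_finsetSum, Finset.sum_range_succ', Finset.sum_range_succ']
    simp [hS, eval_zero_Smon_zero, eval_zero_Smon_succ, sum_pow_eq_ite F j hj, hnd]
  · have hd : Fintype.card F - 1 ∣ j := by tauto
    rw [eval_derivative_Zpoly_one, eval_neg, eval_finsetSum, Finset.sum_range_succ',
      Finset.sum_range_succ']
    simp [hS, eval_zero_Smon_succ, sum_pow_eq_ite F j hj, hd]

/-- Let `j ≥ 1` and let `m = ⌊log_q(j+1)⌋`, i.e. `q^m ≤ j+1 < q^{m+1}`.  Then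
`deg β(j) ≤ j·m`; consequently, for every monic irreducible `π` of degree `d`, the
`π`-adic valuation of `β(j)` satisfies `d·v_π(β(j)) ≤ j·m` (stated as: any `k` with
`π^k ∣ β(j)` satisfies `d·k ≤ j·m`). -/
theorem stmt10 (F : Type) [Field F] [Fintype F] (hq : 3 ≤ Fintype.card F)
    (j m : ℕ) (hj : 1 ≤ j)
    (hm1 : Fintype.card F ^ m ≤ j + 1) (hm2 : j + 1 < Fintype.card F ^ (m + 1)) :
    (bg F j).natDegree ≤ j * m ∧
      ∀ (π : Polynomial F) (d : ℕ), π.Monic → Irreducible π → π.natDegree = d →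
        ∀ k : ℕ, π ^ k ∣ bg F j → d * k ≤ j * m := by
  have hdeg := natDegree_bg_le F j m hm2
  refine ⟨hdeg, ?_⟩
  rintro π d - - rfl k hk
  have hne : bg F j ≠ 0 := fun h => by
    simpa [h] using eval_zero_bg F j (Nat.one_le_iff_ne_zero.1 hj)
  have := natDegree_le_of_dvd hk hne
  rw [natDegree_pow, mul_comm] at this
  exact this.trans hdeg
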